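/- arXiv:1201.3595 — 3 statements merged into one kernel-verified Lean document; each statement's English description precedes it below -/
import Mathlib

section
/- Let G be a group containing a finitely generated nilpotent normal subgroup N such that the quotient group G/N is finite. Then the center 𝒵(G) of G is finitely generated. -/
open scoped commutatorElement

namespace Subgroup

variable {G Q : Type*} [Group G] [Group Q]

theorem FG.map {H : Subgroup G} (hH : H.FG) (f : G →* Q) : (H.map f).FG := by
  rw [fg_iff_submonoid_fg] at hH ⊢
  exact hH.map f

theorem FG.exists_fg_le_map_eq {f : G →* Q} {H : Subgroup G} (hH : (H.map f).FG) :
    ∃ K ≤ H, K.FG ∧ K.map f = H.map f := by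
  classical
  obtain ⟨S, hS⟩ := hH
  have hSH : (S : Set Q) ⊆ f '' H := by
    rw [← coe_map, ← hS]
    exact subset_closure
  obtain ⟨T, hTH, hTS⟩ := Finset.subset_set_image_iff.mp hSH
  refine ⟨closure T, (closure_le H).mpr hTH, ⟨T, rfl⟩, ?_⟩
  rw [MonoidHom.map_closure, ← hS, ← hTS, Finset.coe_image]

theorem FG.of_map_of_inf_ker {f : G →* Q} {H : Subgroup G} (hmap : (H.map f).FG)
    (hker : (H ⊓ f.ker).FG) : H.FG := by
  obtain ⟨K, hKH, hK, hKf⟩ := hmap.exists_fg_le_map_eq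
  suffices H = K ⊔ H ⊓ f.ker from this ▸ hK.sup hker
  refine le_antisymm (fun x hx => ?_) (sup_le hKH inf_le_left)
  obtain ⟨k, hk, hkx⟩ : f x ∈ K.map f := hKf ▸ mem_map_of_mem f hx
  rw [← mul_inv_cancel_left k x]
  refine mul_mem_sup hk ⟨H.mul_mem (H.inv_mem (hKH hk)) hx, ?_⟩
  simp [hkx]

theorem FG.of_forall_subgroup_fg {N H : Subgroup G} (hN : ∀ K : Subgroup N, K.FG) (h : H ≤ N) :
    H.FG := by
  have := (hN (H.subgroupOf N)).map N.subtype
  rwa [map_subgroupOf_eq_of_le h] at this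

theorem fg_of_isMulCommutative {A : Type*} [Group A] [IsMulCommutative A] [Group.FG A]
    (H : Subgroup A) : H.FG := by
  let _ : CommGroup A := { ‹Group A› with mul_comm := mul_comm' }
  have : Module.Finite ℤ (Additive A) := Module.Finite.iff_addGroup_fg.mpr inferInstance
  rw [fg_iff_add_fg, ← AddSubgroup.toIntSubmodule_toAddSubgroup H.toAddSubgroup,
    ← Submodule.fg_iff_addSubgroup_fg]
  exact IsNoetherian.noetherian _

theorem FG.of_le_center {H K : Subgroup G} (hK : K.FG) (hKZ : K ≤ center G) (hHK : H ≤ K) :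
    H.FG := by
  have : IsMulCommutative K :=
    le_centralizer_iff_isMulCommutative.mp (hKZ.trans (center_le_centralizer _))
  have : Group.FG K := (Group.fg_iff_subgroup_fg K).mpr hK
  exact FG.of_forall_subgroup_fg fg_of_isMulCommutative hHK

theorem normal_of_le_center {H : Subgroup G} (h : H ≤ center G) : H.Normal where
  conj_mem n hn g := by rwa [mem_center_iff.mp (h hn) g, mul_inv_cancel_right]

theorem FG.commutator {H K : Subgroup G} (hH : H.FG) (hK : K.FG) (h : ⁅H, K⁆ ≤ center G) :
    ⁅H, K⁆.FG := by
  obtain ⟨S, rfl⟩ := hH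
  obtain ⟨T, rfl⟩ := hK
  set R : Subgroup G := closure (Set.image2 (fun s t => ⁅s, t⁆) (S : Set G) (T : Set G))
  have hR : R ≤ ⁅closure (S : Set G), closure (T : Set G)⁆ := by
    rw [closure_le]
    rintro _ ⟨s, hs, t, ht, rfl⟩
    exact commutator_mem_commutator (subset_closure hs) (subset_closure ht)
  have : R.Normal := normal_of_le_center (hR.trans h)
  suffices ⁅closure (S : Set G), closure (T : Set G)⁆ = R from
    (fg_iff _).mpr ⟨_, this.symm, S.finite_toSet.image2 _ T.finite_toSet⟩
  refine le_antisymm ?_ hR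
  rw [← QuotientGroup.ker_mk' R, ← map_eq_bot_iff, map_commutator, MonoidHom.map_closure,
    MonoidHom.map_closure, commutator_eq_bot_iff_le_centralizer, centralizer_closure, closure_le]
  rintro _ ⟨s, hs, rfl⟩ _ ⟨t, ht, rfl⟩
  symm
  rw [← commutatorElement_eq_one_iff_mul_comm, ← map_commutatorElement, ← MonoidHom.mem_ker,
    QuotientGroup.ker_mk']
  exact subset_closure ⟨s, hs, t, ht, rfl⟩

theorem lowerCentralSeries_succ_fg [Group.FG G] {n : ℕ}
    (hn : lowerCentralSeries (⊤ : Subgroup G) (n + 1) ≤ center G)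
    (hQ : ((lowerCentralSeries (⊤ : Subgroup G) n).map
      (QuotientGroup.mk' (lowerCentralSeries (⊤ : Subgroup G) (n + 1)))).FG) :
    (lowerCentralSeries (⊤ : Subgroup G) (n + 1)).FG := by
  obtain ⟨K, hKle, hK, hKmap⟩ := hQ.exists_fg_le_map_eq
  suffices lowerCentralSeries (⊤ : Subgroup G) (n + 1) = ⁅K, ⊤⁆ by
    rw [this] at hn ⊢
    exact hK.commutator (Group.fg_def.mp inferInstance) hn
  refine le_antisymm (commutator_le.mpr fun x hx y _ => ?_) (commutator_mono hKle le_rfl)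
  obtain ⟨k, hk, hkx⟩ := hKmap ▸ mem_map_of_mem (QuotientGroup.mk' _) hx
  have hz : k⁻¹ * x ∈ center G := hn (QuotientGroup.eq.mp hkx)
  have hcomm : ⁅x, y⁆ = ⁅k, y⁆ := by
    obtain ⟨z, rfl⟩ : ∃ z, x = k * z := ⟨k⁻¹ * x, by group⟩
    rw [inv_mul_cancel_left] at hz
    have := mem_center_iff.mp hz y
    simp only [commutatorElement_def, mul_inv_rev, mul_assoc]
    rw [← mul_assoc z y, ← this]
    simp [mul_assoc]
  rw [hcomm]
  exact commutator_mem_commutator hk (mem_top y)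

theorem fg_of_lowerCentralSeries_eq_bot (n : ℕ) {G : Type*} [Group G] [Group.FG G]
    (hG : lowerCentralSeries (⊤ : Subgroup G) n = ⊥) (H : Subgroup G) : H.FG := by
  induction n generalizing G with
  | zero =>
    rw [eq_bot_iff.mpr (le_top.trans hG.le : H ≤ ⊥)]
    exact FG.bot
  | succ n ih =>
    have hZ : lowerCentralSeries (⊤ : Subgroup G) n ≤ center G :=
      commutator_top_right_eq_bot_iff_le_center.mp hG
    set f := QuotientGroup.mk' (lowerCentralSeries (⊤ : Subgroup G) n)
    have hQ : ∀ K : Subgroup (G ⧸ lowerCentralSeries (⊤ : Subgroup G) n), K.FG := by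
      refine fun K => ih ?_ K
      rw [← map_top_of_surjective f (QuotientGroup.mk'_surjective _), ← map_lowerCentralSeries,
        map_eq_bot_iff, QuotientGroup.ker_mk']
    have hfg : (lowerCentralSeries (⊤ : Subgroup G) n).FG := by
      cases n with
      | zero => exact Group.fg_def.mp inferInstance
      | succ m => exact lowerCentralSeries_succ_fg hZ (hQ _)
    refine FG.of_map_of_inf_ker (f := f) (hQ _) (hfg.of_le_center hZ ?_)
    exact inf_le_right.trans (QuotientGroup.ker_mk' _).le

theorem fg_of_isNilpotent [Group.FG G] [Group.IsNilpotent G] (H : Subgroup G) : H.FG :=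
  have ⟨n, hn⟩ := nilpotent_iff_lowerCentralSeries.mp ‹Group.IsNilpotent G›
  fg_of_lowerCentralSeries_eq_bot n hn H

end Subgroup

/-- If a group `G` contains a finitely generated nilpotent normal subgroup `N` with
finite quotient `G ⧸ N`, then the center of `G` is finitely generated. -/
theorem center_fg_of_fg_nilpotent_normal_finite_quotient
    {G : Type*} [Group G] (N : Subgroup G) [N.Normal]
    (hfg : N.FG) (hnilp : Group.IsNilpotent N) (hfin : Finite (G ⧸ N)) :
    (Subgroup.center G).FG := by
  have : Group.FG N := (Group.fg_iff_subgroup_fg N).mpr hfg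
  refine Subgroup.FG.of_map_of_inf_ker (f := QuotientGroup.mk' N) ?_ ?_
  · exact (Group.fg_iff_subgroup_fg _).mp inferInstance
  · rw [QuotientGroup.ker_mk']
    exact Subgroup.FG.of_forall_subgroup_fg Subgroup.fg_of_isNilpotent inf_le_right
end

section
/- Let G be a group containing a normal subgroup N of finite index such that the center 𝒵(N) of N is infinite. Then G has infinitely many distinct conjugacy classes. -/
/-- An element commuting with every element of a subgroup of finite index has only finitely
many conjugates. -/
theorem finite_setOf_isConj_of_le_centralizer {G : Type*} [Group G] (N : Subgroup G)
    [N.FiniteIndex] {z : G} (hz : N ≤ Subgroup.centralizer {z}) :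
    {x | IsConj z x}.Finite := by
  refine (Set.finite_range fun q : G ⧸ N ↦ q.out * z * q.out⁻¹).subset ?_
  intro x hx
  obtain ⟨g, rfl⟩ := isConj_iff.1 hx
  obtain ⟨n, hn⟩ := QuotientGroup.mk_out_eq_mul N g
  have hnz : (n : G) * z = z * n := Subgroup.mem_centralizer_singleton_iff.1 (hz n.2)
  refine ⟨g, ?_⟩
  simp only [hn]
  rw [mul_assoc g, hnz]
  group

/-- If a group `G` contains a normal subgroup `N` of finite index whose center is
infinite, then `G` has infinitely many conjugacy classes. -/
theorem infinite_conjClasses_of_infinite_center_of_normal_finiteIndex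
    {G : Type*} [Group G] (N : Subgroup G) [N.Normal] [N.FiniteIndex]
    (hinf : Infinite (Subgroup.center N)) :
    Infinite (ConjClasses G) := by
  by_contra h
  rw [not_infinite_iff_finite] at h
  obtain ⟨c, hc⟩ := Finite.exists_infinite_fiber
    fun z : Subgroup.center N ↦ ConjClasses.mk ((z : N) : G)
  rw [Set.infinite_coe_iff] at hc
  obtain ⟨z, rfl⟩ := hc.nonempty
  have hz : N ≤ Subgroup.centralizer {((z : N) : G)} := fun n hn ↦
    Subgroup.mem_centralizer_singleton_iff.2
      (congrArg Subtype.val (Subgroup.mem_center_iff.1 z.2 ⟨n, hn⟩))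
  refine hc (((finite_setOf_isConj_of_le_centralizer N hz).preimage
    (Subtype.val_injective.comp Subtype.val_injective).injOn).subset fun w hw ↦ ?_)
  exact (ConjClasses.mk_eq_mk_iff_isConj.1 hw).symm
end

section
/- Let V be an infinite-dimensional vector space over the field ℤ/2ℤ and let τ : V → V be a linear involution (τ² = id). Then the quotient group V / {v + τ(v) : v ∈ V} of V by the subgroup consisting of all elements of the form v + τ(v) is infinite (equivalently, it is an infinite-dimensional vector space over ℤ/2ℤ). -/
/-- If `V` is an infinite-dimensional vector space over `ℤ/2ℤ` and `τ : V → V` is a linear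
involution, then the quotient of `V` by the subspace `{v + τ v : v ∈ V}` is infinite. -/
theorem quotient_by_norm_subspace_infinite
    {V : Type*} [AddCommGroup V] [Module (ZMod 2) V]
    (hinf : ¬ Module.Finite (ZMod 2) V)
    (τ : V →ₗ[ZMod 2] V) (hτ : ∀ v, τ (τ v) = v) :
    Infinite (V ⧸ LinearMap.range (LinearMap.id + τ)) := by
  rw [← not_finite_iff_infinite]
  intro hfin
  set N : V →ₗ[ZMod 2] V := LinearMap.id + τ with hN
  have hrange_le_ker : LinearMap.range N ≤ LinearMap.ker N := by
    rintro _ ⟨v, rfl⟩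
    have add_self : ∀ w : V, w + w = 0 := fun w => by
      rw [← two_smul (ZMod 2) w, show (2 : ZMod 2) = 0 from rfl, zero_smul]
    simp only [LinearMap.mem_ker, hN, LinearMap.add_apply, LinearMap.id_apply, map_add, hτ]
    rw [add_comm (τ v) v, add_self]
  have hquot : Module.Finite (ZMod 2) (V ⧸ LinearMap.range N) := Module.Finite.of_finite
  have hrange : Module.Finite (ZMod 2) (LinearMap.range N) := by
    rw [← Submodule.range_liftQ (LinearMap.range N) N hrange_le_ker]
    exact Module.Finite.range _
  exact hinf (Module.Finite.of_submodule_quotient (LinearMap.range N))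
end
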